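/- For the cycle C_n on n ≥ 4 vertices, the lower split parameters satisfy ir_s(C_n) = γ_s(C_n) = i_s(C_n) = ⌈n/3⌉. -/

import Mathlib

open SimpleGraph

namespace SplitDomination

variable {V : Type*}

/-- `S` is an independent set of `G`. -/
def Indep (G : SimpleGraph V) (S : Set V) : Prop :=
  ∀ ⦃u⦄, u ∈ S → ∀ ⦃v⦄, v ∈ S → ¬ G.Adj u v

/-- `S` is a dominating set of `G`. -/
def Dominating (G : SimpleGraph V) (S : Set V) : Prop :=
  ∀ v ∉ S, ∃ u ∈ S, G.Adj u v

/-- The closed neighborhood `N[S]` of a set `S`. -/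
def ClosedNbhd (G : SimpleGraph V) (S : Set V) : Set V :=
  {w | w ∈ S ∨ ∃ u ∈ S, G.Adj u w}

/-- `u` has a private neighbor with respect to `S`:
a vertex `w ∈ N[u]` with `w ∉ N[S \ {u}]`. -/
def HasPrivateNbr (G : SimpleGraph V) (S : Set V) (u : V) : Prop :=
  ∃ w, (w = u ∨ G.Adj u w) ∧ w ∉ ClosedNbhd G (S \ {u})

/-- The induced subgraph `⟨T⟩` is disconnected or consists of a single vertex. -/
def DisconnOrK1 (G : SimpleGraph V) (T : Set V) : Prop :=
  ¬ (G.induce T).Connected ∨ T.ncard = 1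

/-- `G` has no isolated vertices. -/
def NoIsolated (G : SimpleGraph V) : Prop :=
  ∀ v : V, ∃ u, G.Adj u v

/-- `S` is a split dominating set: dominating, and `⟨V ∖ S⟩` is disconnected or a `K₁`. -/
def SplitDominating (G : SimpleGraph V) (S : Set V) : Prop :=
  Dominating G S ∧ DisconnOrK1 G Sᶜ

/-- `S` is a minimal split dominating set. -/
def MinimalSplitDominating (G : SimpleGraph V) (S : Set V) : Prop :=
  SplitDominating G S ∧
    ∀ u ∈ S, HasPrivateNbr G S u ∨ (G.induce (Sᶜ ∪ {u})).Connected

/-- `S` is a split independent set: independent, and `⟨V ∖ S⟩` is disconnected or a `K₁`. -/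
def SplitIndep (G : SimpleGraph V) (S : Set V) : Prop :=
  Indep G S ∧ DisconnOrK1 G Sᶜ

/-- `S` is a maximal split independent set. -/
def MaximalSplitIndep (G : SimpleGraph V) (S : Set V) : Prop :=
  SplitIndep G S ∧
    ∀ v ∉ S, ¬ Indep G (S ∪ {v}) ∨ (G.induce (S ∪ {v})ᶜ).Connected

/-- `S` is a split irredundant set: every vertex of `S` has a private neighbor
with respect to `S`, and `⟨V ∖ S⟩` is disconnected or a `K₁`. -/
def SplitIrred (G : SimpleGraph V) (S : Set V) : Prop :=
  (∀ u ∈ S, HasPrivateNbr G S u) ∧ DisconnOrK1 G Sᶜ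

/-- `S` is a maximal split irredundant set. -/
def MaximalSplitIrred (G : SimpleGraph V) (S : Set V) : Prop :=
  SplitIrred G S ∧
    ∀ v ∉ S, ¬ HasPrivateNbr G (S ∪ {v}) v ∨ (G.induce (S ∪ {v})ᶜ).Connected

/-- Split domination number `γₛ(G)`. -/
noncomputable def gammaS (G : SimpleGraph V) : ℕ :=
  sInf {n | ∃ S : Set V, SplitDominating G S ∧ S.ncard = n}

/-- Upper split domination number `Γₛ(G)`. -/
noncomputable def GammaS (G : SimpleGraph V) : ℕ :=
  sSup {n | ∃ S : Set V, MinimalSplitDominating G S ∧ S.ncard = n}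

/-- Lower split independence number `iₛ(G)`. -/
noncomputable def iS (G : SimpleGraph V) : ℕ :=
  sInf {n | ∃ S : Set V, MaximalSplitIndep G S ∧ S.ncard = n}

/-- Split independence number `βₛ(G)`. -/
noncomputable def betaS (G : SimpleGraph V) : ℕ :=
  sSup {n | ∃ S : Set V, MaximalSplitIndep G S ∧ S.ncard = n}

/-- Lower split irredundance number `irₛ(G)`. -/
noncomputable def irS (G : SimpleGraph V) : ℕ :=
  sInf {n | ∃ S : Set V, MaximalSplitIrred G S ∧ S.ncard = n}

/-- Upper split irredundance number `IRₛ(G)`. -/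
noncomputable def IRS (G : SimpleGraph V) : ℕ :=
  sSup {n | ∃ S : Set V, MaximalSplitIrred G S ∧ S.ncard = n}

/-- The vertex connectivity `k(G)`: the minimum size of a set `S`
such that `⟨V ∖ S⟩` is disconnected or a single vertex. -/
noncomputable def connK (G : SimpleGraph V) : ℕ :=
  sInf {n | ∃ S : Set V, DisconnOrK1 G Sᶜ ∧ S.ncard = n}

/-- `S` is a nonsplit dominating set: dominating and `⟨V ∖ S⟩` is connected. -/
def NonsplitDominating (G : SimpleGraph V) (S : Set V) : Prop :=
  Dominating G S ∧ (G.induce Sᶜ).Connected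

/-- `S` is a minimal nonsplit dominating set. -/
def MinimalNonsplitDominating (G : SimpleGraph V) (S : Set V) : Prop :=
  NonsplitDominating G S ∧
    ∀ u ∈ S, HasPrivateNbr G S u ∨ DisconnOrK1 G (Sᶜ ∪ {u})

/-- `S` is a nonsplit independent set: independent and `⟨V ∖ S⟩` is connected. -/
def NonsplitIndep (G : SimpleGraph V) (S : Set V) : Prop :=
  Indep G S ∧ (G.induce Sᶜ).Connected

/-- `S` is a maximal nonsplit independent set. -/
def MaximalNonsplitIndep (G : SimpleGraph V) (S : Set V) : Prop :=
  NonsplitIndep G S ∧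
    ∀ v ∉ S, ¬ Indep G (S ∪ {v}) ∨ DisconnOrK1 G (S ∪ {v})ᶜ

/-- `S` is a nonsplit irredundant set. -/
def NonsplitIrred (G : SimpleGraph V) (S : Set V) : Prop :=
  (∀ u ∈ S, HasPrivateNbr G S u) ∧ (G.induce Sᶜ).Connected

/-- `S` is a maximal nonsplit irredundant set. -/
def MaximalNonsplitIrred (G : SimpleGraph V) (S : Set V) : Prop :=
  NonsplitIrred G S ∧
    ∀ v ∉ S, ¬ HasPrivateNbr G (S ∪ {v}) v ∨ DisconnOrK1 G (S ∪ {v})ᶜ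

/-- Nonsplit domination number `γₙₛ(G)`. -/
noncomputable def gammaNS (G : SimpleGraph V) : ℕ :=
  sInf {n | ∃ S : Set V, NonsplitDominating G S ∧ S.ncard = n}

/-- Upper nonsplit domination number `Γₙₛ(G)`. -/
noncomputable def GammaNS (G : SimpleGraph V) : ℕ :=
  sSup {n | ∃ S : Set V, MinimalNonsplitDominating G S ∧ S.ncard = n}

/-- Lower nonsplit independence number `iₙₛ(G)`. -/
noncomputable def iNS (G : SimpleGraph V) : ℕ :=
  sInf {n | ∃ S : Set V, MaximalNonsplitIndep G S ∧ S.ncard = n}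

/-- Nonsplit independence number `βₙₛ(G)`. -/
noncomputable def betaNS (G : SimpleGraph V) : ℕ :=
  sSup {n | ∃ S : Set V, MaximalNonsplitIndep G S ∧ S.ncard = n}

/-- Lower nonsplit irredundance number `irₙₛ(G)`. -/
noncomputable def irNS (G : SimpleGraph V) : ℕ :=
  sInf {n | ∃ S : Set V, MaximalNonsplitIrred G S ∧ S.ncard = n}

/-- `G` is a 2-tree: it can be built from `K₃` by repeatedly adding a new vertex
adjacent to exactly the two endpoints of an existing edge.  This is expressed via a
construction ordering of the vertices. -/
def IsTwoTree [Fintype V] (G : SimpleGraph V) : Prop :=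
  ∃ (n : ℕ) (_ : 3 ≤ n) (e : V ≃ Fin n),
    (∀ i j : Fin n, i ≠ j → i.val < 3 → j.val < 3 → G.Adj (e.symm i) (e.symm j)) ∧
    (∀ i : Fin n, 3 ≤ i.val → ∃ j k : Fin n, j < i ∧ k < i ∧ j ≠ k ∧
      G.Adj (e.symm j) (e.symm k) ∧
      (∀ l : Fin n, l < i → (G.Adj (e.symm l) (e.symm i) ↔ l = j ∨ l = k)))

/-- Adding a vertex adjacent to some vertex of `T` keeps `⟨T⟩` connected. -/
theorem induce_insert_connected {G : SimpleGraph V} {T : Set V} {u v : V}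
    (hT : (G.induce T).Connected) (hu : u ∈ T) (huv : G.Adj v u) :
    (G.induce (insert v T)).Connected := by
  have h := induce_union_connected (induce_pair_connected_of_adj huv).preconnected hT.preconnected
    ⟨u, by simp, hu⟩
  have e : ({v, u} ∪ T : Set V) = insert v T := by
    rw [Set.insert_union, Set.singleton_union, Set.insert_eq_of_mem hu]
  rwa [e] at h

/-- If `⟨V ∖ S⟩` is disconnected or a `K₁` and deleting a further vertex `v` makes it
connected, then `v` is adjacent to a vertex of `S`. -/
theorem exists_adj_of_connected_compl {G : SimpleGraph V} (hG : NoIsolated G) {S : Set V}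
    (hS : DisconnOrK1 G Sᶜ) {v : V} (hv : v ∉ S) (hc : (G.induce (S ∪ {v})ᶜ).Connected) :
    ∃ u ∈ S, G.Adj u v := by
  obtain ⟨u, huv⟩ := hG v
  by_contra! h
  have huS : u ∉ S := fun hu => h u hu huv
  rcases hS with hS | hS
  · apply hS
    have h1 := induce_insert_connected hc (u := u) (by simp [huS, huv.ne]) huv.symm
    have e : insert v (S ∪ {v})ᶜ = Sᶜ := by
      ext x
      by_cases hx : x = v <;> simp [hx, hv]
    rwa [e] at h1
  · obtain ⟨a, ha⟩ := Set.ncard_eq_one.1 hS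
    have hua : u ∈ ({a} : Set V) := ha ▸ huS
    have hva : v ∈ ({a} : Set V) := ha ▸ hv
    exact huv.ne (hua.trans hva.symm)

theorem MaximalSplitIndep.dominating {G : SimpleGraph V} (hG : NoIsolated G) {S : Set V}
    (hS : MaximalSplitIndep G S) : Dominating G S := by
  intro v hv
  rcases hS.2 v hv with h | h
  · by_contra! hn
    refine h fun a ha b hb hab => ?_
    rcases ha with ha | rfl <;> rcases hb with hb | rfl
    · exact hS.1.1 ha hb hab
    · exact hn a ha hab
    · exact hn b hb hab.symm
    · exact hab.ne rfl
  · exact exists_adj_of_connected_compl hG hS.1.2 hv h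

theorem MaximalSplitIrred.dominating {G : SimpleGraph V} (hG : NoIsolated G) {S : Set V}
    (hS : MaximalSplitIrred G S) : Dominating G S := by
  intro v hv
  rcases hS.2 v hv with h | h
  · by_contra! hn
    refine h ⟨v, Or.inl rfl, ?_⟩
    rintro (⟨-, hx⟩ | ⟨u, ⟨hu | hu, hne⟩, hadj⟩)
    · exact hx rfl
    · exact hn u hu hadj
    · exact hne hu
  · exact exists_adj_of_connected_compl hG hS.1.2 hv h

theorem maximalSplitIndep_of_dominating {G : SimpleGraph V} {S : Set V} (hi : Indep G S)
    (hd : Dominating G S) (hs : DisconnOrK1 G Sᶜ) : MaximalSplitIndep G S := by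
  refine ⟨⟨hi, hs⟩, fun v hv => Or.inl fun h => ?_⟩
  obtain ⟨u, hu, huv⟩ := hd v hv
  exact h (Or.inl hu) (Or.inr rfl) huv

theorem maximalSplitIrred_of_dominating {G : SimpleGraph V} {S : Set V} (hi : Indep G S)
    (hd : Dominating G S) (hs : DisconnOrK1 G Sᶜ) : MaximalSplitIrred G S := by
  refine ⟨⟨fun u hu => ⟨u, Or.inl rfl, ?_⟩, hs⟩, fun v hv => Or.inl ?_⟩
  · rintro (⟨-, hx⟩ | ⟨w, ⟨hw, -⟩, hadj⟩)
    · exact hx rfl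
    · exact hi hw hu hadj
  · rintro ⟨w, -, hw⟩
    apply hw
    by_cases hwS : w ∈ S
    · exact Or.inl ⟨Or.inl hwS, fun h => hv (h ▸ hwS)⟩
    · obtain ⟨u, hu, huw⟩ := hd w hwS
      exact Or.inr ⟨u, ⟨Or.inl hu, fun h => hv (h ▸ hu)⟩, huw⟩

/-- A set of vertices that is closed under adjacency within `T` and splits `T` into two
nonempty parts witnesses that `⟨T⟩` is disconnected. -/
theorem not_connected_induce {G : SimpleGraph V} {T A : Set V}
    (hA : ∀ x ∈ T, ∀ y ∈ T, G.Adj x y → x ∈ A → y ∈ A) {a b : V} (ha : a ∈ T) (hb : b ∈ T)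
    (haA : a ∈ A) (hbA : b ∉ A) : ¬ (G.induce T).Connected := by
  intro h
  obtain ⟨p⟩ := h.preconnected ⟨a, ha⟩ ⟨b, hb⟩
  have key : ∀ {x y : T}, (G.induce T).Walk x y → (x : V) ∈ A → (y : V) ∈ A := by
    intro x y p
    induction p with
    | nil => exact id
    | cons hxy _ ih => exact fun hx => ih (hA _ (Subtype.prop _) _ (Subtype.prop _) hxy hx)
  exact hbA (key p haA)

theorem cycleGraph_adj_iff_val {n : ℕ} (hn : 2 ≤ n) {u v : Fin n} :
    (cycleGraph n).Adj u v ↔ u.val + 1 = v.val ∨ v.val + 1 = u.val ∨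
      (u.val = 0 ∧ v.val + 1 = n) ∨ (v.val = 0 ∧ u.val + 1 = n) := by
  rw [cycleGraph_adj']
  have hu := u.isLt
  have hv := v.isLt
  rcases lt_trichotomy u v with h | rfl | h
  · rw [Fin.sub_val_of_le h.le, Fin.coe_sub_iff_lt.2 h]
    rw [Fin.lt_def] at h
    omega
  · have := Fin.sub_val_of_le (le_refl u)
    omega
  · rw [Fin.sub_val_of_le h.le, Fin.coe_sub_iff_lt.2 h]
    rw [Fin.lt_def] at h
    omega

theorem noIsolated_cycleGraph {n : ℕ} (hn : 2 ≤ n) : NoIsolated (cycleGraph n) := by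
  obtain ⟨m, rfl⟩ := Nat.exists_eq_add_of_le' hn
  exact fun v => ⟨v + 1, by rw [cycleGraph_adj]; simp⟩

theorem Dominating.le_three_mul_ncard {n : ℕ} (hn : 2 ≤ n) {S : Set (Fin n)}
    (hS : Dominating (cycleGraph n) S) : n ≤ 3 * S.ncard := by
  obtain ⟨m, rfl⟩ := Nat.exists_eq_add_of_le' hn
  have hsub : (Set.univ : Set (Fin (m + 2))) ⊆ S ∪ ((· + 1) '' S ∪ (· - 1) '' S) := by
    intro v _
    by_cases hv : v ∈ S
    · exact Or.inl hv
    · obtain ⟨u, hu, h | h⟩ := hS v hv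
      · exact Or.inr (Or.inr ⟨u, hu, by simp [← h]⟩)
      · exact Or.inr (Or.inl ⟨u, hu, by simp [← h]⟩)
  have h0 := Set.ncard_le_ncard hsub
  rw [Set.ncard_univ, Nat.card_fin] at h0
  have h1 := Set.ncard_union_le S ((· + 1) '' S ∪ (· - 1) '' S)
  have h2 := Set.ncard_union_le ((· + 1) '' S) ((· - 1) '' S)
  have h3 := Set.ncard_image_le (f := (· + 1)) S.toFinite
  have h4 := Set.ncard_image_le (f := (· - 1)) S.toFinite
  omega

/-- The vertices `0, 3, 6, …` of `Cₙ`, the last one moved back to `n - 2` if it would be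
`n - 1`, form an independent dominating set of size `⌈n/3⌉` with disconnected complement. -/
theorem exists_indep_dominating_cycleGraph {n : ℕ} (hn : 4 ≤ n) :
    ∃ S : Set (Fin n), Indep (cycleGraph n) S ∧ Dominating (cycleGraph n) S ∧
      DisconnOrK1 (cycleGraph n) Sᶜ ∧ S.ncard = (n + 2) / 3 := by
  let f : Fin ((n + 2) / 3) → Fin n := fun i => ⟨min (3 * i.val) (n - 2), by omega⟩
  have hmem (x : Fin n) :
      x ∈ Set.range f ↔ x.val % 3 = 0 ∧ x.val + 1 ≠ n ∨ n % 3 = 1 ∧ x.val + 2 = n := by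
    have hx := x.isLt
    constructor
    · rintro ⟨i, rfl⟩
      have hi := i.isLt
      simp only [f]
      omega
    · intro h
      refine ⟨⟨(x.val + 2) / 3, by omega⟩, Fin.ext ?_⟩
      simp only [f]
      omega
  refine ⟨Set.range f, ?_, ?_, Or.inl ?_, ?_⟩
  · intro u hu v hv
    rw [hmem] at hu hv
    rw [cycleGraph_adj_iff_val (by omega)]
    omega
  · intro v hv
    rw [hmem] at hv
    have hlt := v.isLt
    by_cases h1 : v.val % 3 = 1
    · refine ⟨⟨v.val - 1, by omega⟩, ?_⟩
      rw [hmem, cycleGraph_adj_iff_val (by omega)]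
      simp only
      omega
    · by_cases h2 : v.val + 1 = n
      · refine ⟨⟨0, by omega⟩, ?_⟩
        rw [hmem, cycleGraph_adj_iff_val (by omega)]
        simp only [true_and]
        omega
      · refine ⟨⟨v.val + 1, by omega⟩, ?_⟩
        rw [hmem, cycleGraph_adj_iff_val (by omega)]
        simp only [true_or, or_true, and_true]
        omega
  · refine not_connected_induce (A := {x | x.val < min 3 (n - 2)})
      (a := ⟨1, by omega⟩) (b := ⟨n - 1, by omega⟩) ?_ ?_ ?_ ?_ ?_
    · intro x hx y hy hxy
      rw [Set.mem_compl_iff, hmem] at hx hy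
      rw [cycleGraph_adj_iff_val (by omega)] at hxy
      simp only [Set.mem_ofPred_eq]
      omega
    · rw [Set.mem_compl_iff, hmem]
      simp only
      omega
    · rw [Set.mem_compl_iff, hmem]
      simp only
      omega
    · simp only [Set.mem_ofPred_eq]
      omega
    · simp only [Set.mem_ofPred_eq]
      omega
  · have hf : Function.Injective f := by
      intro i j hij
      have h := congrArg Fin.val hij
      simp only [f] at h
      have hi := i.isLt
      have hj := j.isLt
      exact Fin.ext (by omega)
    rw [← Set.image_univ, Set.ncard_image_of_injective _ hf, Set.ncard_univ, Nat.card_fin]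

/-- For the cycle `Cₙ`, `n ≥ 4`:
`irₛ = γₛ = iₛ = ⌈n/3⌉`.  (Note `⌈n/3⌉ = (n + 2) / 3` in `ℕ`.) -/
theorem cycle_lower_split_params (n : ℕ) (hn : 4 ≤ n) :
    irS (SimpleGraph.cycleGraph n) = (n + 2) / 3 ∧
    gammaS (SimpleGraph.cycleGraph n) = (n + 2) / 3 ∧
    iS (SimpleGraph.cycleGraph n) = (n + 2) / 3 := by
  obtain ⟨S, hi, hd, hs, hcard⟩ := exists_indep_dominating_cycleGraph hn
  have hG := noIsolated_cycleGraph (n := n) (by omega)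
  have key (P : Set (Fin n) → Prop) (hP : P S)
      (hdom : ∀ T, P T → Dominating (cycleGraph n) T) :
      sInf {k | ∃ T : Set (Fin n), P T ∧ T.ncard = k} = (n + 2) / 3 := by
    refine IsLeast.csInf_eq ⟨⟨S, hP, hcard⟩, ?_⟩
    rintro k ⟨T, hT, rfl⟩
    have := (hdom T hT).le_three_mul_ncard (by omega)
    omega
  exact ⟨key _ (maximalSplitIrred_of_dominating hi hd hs) fun _ hT => hT.dominating hG,
    key _ ⟨hd, hs⟩ fun _ hT => hT.1,
    key _ (maximalSplitIndep_of_dominating hi hd hs) fun _ hT => hT.dominating hG⟩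

end SplitDomination
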